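/- Let G be a 3-connected graph and let H be a 3-connected subgraph of G. Suppose v is an H-private vertex of G and {A,B} is a 3-separation of G with v ∈ V(A) ∩ V(B). Then {(A ∩ H) − v, (B ∩ H) − v} is a 2-separation of H − v. -/

import Mathlib

open SimpleGraph

/-- A graph is `k`-connected if it has more than `k` vertices and the deletion of any set of
fewer than `k` vertices leaves a connected graph (equivalently, there is no vertex cut of size
less than `k`). -/
def KConnected {V : Type*} (k : ℕ) (G : SimpleGraph V) : Prop :=
  k < Nat.card V ∧ ∀ S : Set V, S.ncard < k → (G.induce Sᶜ).Connected

/-- `{A, B}` is a `k`-separation of the subgraph `K`: `A` and `B` are edge-disjoint subgraphs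
whose union is `K`, sharing exactly `k` vertices, each having at least `k + 1` vertices. -/
def IsKSepPair {V : Type*} (k : ℕ) {G : SimpleGraph V} (K A B : G.Subgraph) : Prop :=
  Disjoint A.edgeSet B.edgeSet ∧ A ⊔ B = K ∧ (A.verts ∩ B.verts).ncard = k ∧
    k + 1 ≤ A.verts.ncard ∧ k + 1 ≤ B.verts.ncard

/-- `{A, B}` is a `k`-separation of the graph `G`. -/
def IsKSeparation {V : Type*} (k : ℕ) (G : SimpleGraph V) (A B : G.Subgraph) : Prop :=
  IsKSepPair k ⊤ A B

theorem KConnected.exists_adj_crossing {V : Type*} {k : ℕ} {G : SimpleGraph V}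
    (hG : KConnected k G) {S P : Set V} (hS : S.ncard < k) {p q : V}
    (hp : p ∉ S) (hq : q ∉ S) (hpP : p ∈ P) (hqP : q ∉ P) :
    ∃ a b, a ∈ P ∧ b ∉ P ∧ a ∉ S ∧ b ∉ S ∧ G.Adj a b := by
  obtain ⟨w⟩ := (hG.2 S hS).preconnected ⟨p, hp⟩ ⟨q, hq⟩
  obtain ⟨d, -, h₁, h₂⟩ := w.exists_boundary_dart {x | (x : V) ∈ P} hpP hqP
  exact ⟨d.fst, d.snd, h₁, h₂, d.fst.2, d.snd.2, d.adj⟩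

theorem IsKSeparation.adj_or_adj {V : Type*} {k : ℕ} {G : SimpleGraph V} {A B : G.Subgraph}
    (h : IsKSeparation k G A B) {a b : V} (hab : G.Adj a b) : A.Adj a b ∨ B.Adj a b := by
  have : (A ⊔ B).Adj a b := by rw [h.2.1]; exact hab
  exact this

theorem IsKSeparation.symm {V : Type*} {k : ℕ} {G : SimpleGraph V} {A B : G.Subgraph}
    (h : IsKSeparation k G A B) : IsKSeparation k G B A :=
  ⟨h.1.symm, by rw [sup_comm]; exact h.2.1, by rw [Set.inter_comm]; exact h.2.2.1,
    h.2.2.2.2, h.2.2.2.1⟩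

/-- In a `k`-connected graph, a vertex shared by the two sides of a `k`-separation has a
neighbor that lies only on the first side. -/
theorem IsKSeparation.exists_adj_mem_notMem {V : Type*} [Finite V] {k : ℕ} {G : SimpleGraph V}
    (hG : KConnected k G) {A B : G.Subgraph} (h : IsKSeparation k G A B) {v : V}
    (hvA : v ∈ A.verts) (hvB : v ∈ B.verts) : ∃ a, G.Adj v a ∧ a ∈ A.verts ∧ a ∉ B.verts := by
  obtain ⟨p, hpA, hpB⟩ : ∃ p ∈ A.verts, p ∉ B.verts := by
    by_contra! hsub
    have heq : A.verts ∩ B.verts = A.verts := Set.inter_eq_left.2 hsub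
    have h₁ := h.2.2.1
    have h₂ := h.2.2.2.1
    rw [heq] at h₁
    omega
  have hcard : ((A.verts ∩ B.verts) \ {v}).ncard < k := by
    rw [← h.2.2.1]
    exact Set.ncard_sdiff_singleton_lt_of_mem ⟨hvA, hvB⟩
  obtain ⟨a, b, ha, hb, -, hbS, hab⟩ := hG.exists_adj_crossing (P := A.verts \ B.verts)
    hcard (p := p) (q := v) (fun hp => hpB hp.1.2) (fun hv => hv.2 rfl) ⟨hpA, hpB⟩
    (fun hv => hv.2 hvB)
  have hbA : b ∈ A.verts :=
    (h.adj_or_adj hab).elim (fun e => e.snd_mem) (fun e => absurd e.fst_mem ha.2)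
  have hbv : b = v := by
    by_contra hne
    exact hbS ⟨⟨hbA, by_contra fun hbB => hb ⟨hbA, hbB⟩⟩, hne⟩
  exact ⟨a, hbv ▸ hab.symm, ha⟩

/-- A `k`-connected subgraph with vertices strictly inside both sides of a `k`-separation
contains every vertex shared by the two sides. -/
theorem IsKSeparation.inter_verts_subset {V : Type*} [Finite V] {k : ℕ} {G : SimpleGraph V}
    {A B H : G.Subgraph} (h : IsKSeparation k G A B) (hH : KConnected k H.coe) {a b : V}
    (haH : a ∈ H.verts) (haB : a ∉ B.verts) (haA : a ∈ A.verts)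
    (hbH : b ∈ H.verts) (hbA : b ∉ A.verts) : A.verts ∩ B.verts ⊆ H.verts := by
  have hcard : k ≤ (Subtype.val ⁻¹' (A.verts ∩ B.verts) : Set H.verts).ncard := by
    by_contra! hlt
    obtain ⟨x, y, hx, hy, -, hyS, hxy⟩ := hH.exists_adj_crossing
      (P := {x | (x : V) ∈ A.verts \ B.verts}) hlt (p := ⟨a, haH⟩) (q := ⟨b, hbH⟩)
      (fun hp => haB hp.2) (fun hq => hbA hq.1) ⟨haA, haB⟩ (fun hq => hbA hq.1)
    have hyA : (y : V) ∈ A.verts :=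
      (h.adj_or_adj (H.adj_sub hxy)).elim (fun e => e.snd_mem)
        (fun e => absurd e.fst_mem hx.2)
    exact hyS ⟨hyA, by_contra fun hyB => hy ⟨hyA, hyB⟩⟩
  have himage := Set.ncard_image_of_injective
    (Subtype.val ⁻¹' (A.verts ∩ B.verts) : Set H.verts) Subtype.val_injective
  rw [Subtype.image_preimage_coe] at himage
  have heq : H.verts ∩ (A.verts ∩ B.verts) = A.verts ∩ B.verts :=
    Set.eq_of_subset_of_ncard_le Set.inter_subset_right
      (by rw [himage, h.2.2.1]; exact hcard) (Set.toFinite _)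
  exact Set.inter_eq_right.1 heq

/-- If `H` is a 3-connected subgraph of the 3-connected graph `G`, `v` is an
`H`-private vertex, and `{A, B}` is a 3-separation of `G` with `v ∈ V(A) ∩ V(B)`, then
`{(A ∩ H) − v, (B ∩ H) − v}` is a 2-separation of `H − v`. -/
theorem private_vertex_separation {V : Type*} [Fintype V] (G : SimpleGraph V)
    (hG : KConnected 3 G) (H : G.Subgraph) (hH : KConnected 3 H.coe) (v : V)
    (hpriv : insert v (G.neighborSet v) ⊆ H.verts)
    (A B : G.Subgraph) (hsep : IsKSeparation 3 G A B)
    (hvA : v ∈ A.verts) (hvB : v ∈ B.verts) :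
    IsKSepPair 2 (H.deleteVerts {v}) ((A ⊓ H).deleteVerts {v})
      ((B ⊓ H).deleteVerts {v}) := by
  obtain ⟨a, hva, haA, haB⟩ := hsep.exists_adj_mem_notMem hG hvA hvB
  obtain ⟨b, hvb, hbB, hbA⟩ := hsep.symm.exists_adj_mem_notMem hG hvB hvA
  have haH : a ∈ H.verts := hpriv (Set.mem_insert_of_mem _ hva)
  have hbH : b ∈ H.verts := hpriv (Set.mem_insert_of_mem _ hvb)
  have hS := hsep.inter_verts_subset hH haH haB haA hbH hbA
  have hcard : ((A.verts ∩ B.verts) \ {v}).ncard = 2 := by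
    rw [Set.ncard_sdiff_singleton_of_mem (Set.mem_inter hvA hvB), hsep.2.2.1]
  have side : ∀ (C : G.Subgraph) (c : V), A.verts ∩ B.verts ⊆ C.verts → c ∈ C.verts →
      c ∈ H.verts → G.Adj v c → c ∉ A.verts ∩ B.verts →
      2 + 1 ≤ ((C ⊓ H).deleteVerts {v}).verts.ncard := by
    intro C c hSC hcC hcH hvc hc
    rw [← hcard, ← Set.ncard_insert_of_notMem (fun h => hc h.1)]
    refine Set.ncard_le_ncard (Set.insert_subset ⟨⟨hcC, hcH⟩, hvc.ne'⟩ ?_)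
    exact Set.sdiff_subset_sdiff_left (Set.subset_inter hSC hS)
  have hverts : A.verts ∪ B.verts = Set.univ := by
    rw [← Subgraph.verts_sup, hsep.2.1, Subgraph.verts_top]
  refine ⟨?_, ?_, ?_, side A a Set.inter_subset_left haA haH hva (fun h => haB h.2),
    side B b Set.inter_subset_right hbB hbH hvb (fun h => hbA h.1)⟩
  · exact hsep.1.mono
      (Subgraph.edgeSet_mono (Subgraph.deleteVerts_le.trans inf_le_left))
      (Subgraph.edgeSet_mono (Subgraph.deleteVerts_le.trans inf_le_left))
  · ext x y
    · have hx : x ∈ A.verts ∪ B.verts := hverts ▸ Set.mem_univ x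
      simp only [Subgraph.verts_sup, Subgraph.deleteVerts_verts, Subgraph.verts_inf,
        Set.mem_union, Set.mem_sdiff, Set.mem_inter_iff] at hx ⊢
      tauto
    · have hadj : H.Adj x y → A.Adj x y ∨ B.Adj x y := fun h => hsep.adj_or_adj h.adj_sub
      have hHx : H.Adj x y → x ∈ H.verts ∧ y ∈ H.verts := fun h => ⟨h.fst_mem, h.snd_mem⟩
      have hAx : A.Adj x y → x ∈ A.verts ∧ y ∈ A.verts := fun h => ⟨h.fst_mem, h.snd_mem⟩
      have hBx : B.Adj x y → x ∈ B.verts ∧ y ∈ B.verts := fun h => ⟨h.fst_mem, h.snd_mem⟩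
      simp only [Subgraph.sup_adj, Subgraph.deleteVerts_adj, Subgraph.verts_inf,
        Subgraph.inf_adj, Set.mem_inter_iff]
      tauto
  · rw [← hcard]
    congr 1
    ext x
    have hx : x ∈ A.verts → x ∈ B.verts → x ∈ H.verts := fun h₁ h₂ => hS ⟨h₁, h₂⟩
    simp only [Subgraph.deleteVerts_verts, Subgraph.verts_inf, Set.mem_sdiff, Set.mem_inter_iff]
    tauto
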